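/- Let C ⊆ ℝ^d be a pointed rational polyhedral cone, let P ⊆ ℝ^d be a compact set with P ∩ C nonempty, and let p ∈ P ∩ C be a point of maximal Euclidean norm among points of P ∩ C. If x, y ∈ C satisfy x · p > |p|²/2 and y · p > |p|²/2, then x + y ∉ P. -/

import Mathlib

open scoped RealInnerProductSpace

/-- A rational polyhedral cone in Euclidean space: the set of nonnegative real linear
combinations of finitely many integer vectors. -/
def IsRationalPolyhedralCone {d : ℕ} (C : Set (EuclideanSpace ℝ (Fin d))) : Prop :=
  ∃ (k : ℕ) (v : Fin k → EuclideanSpace ℝ (Fin d)), (∀ i j, ∃ z : ℤ, v i j = (z : ℝ)) ∧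
    C = {x | ∃ c : Fin k → ℝ, (∀ i, 0 ≤ c i) ∧ x = ∑ i, c i • v i}

/-- A cone is pointed if `C ∩ (−C) = {0}`. -/
def IsPointed {d : ℕ} (C : Set (EuclideanSpace ℝ (Fin d))) : Prop := C ∩ (-C) = {0}

/-- A rational polyhedral cone is closed under addition. -/
theorem IsRationalPolyhedralCone.add_mem {d : ℕ} {C : Set (EuclideanSpace ℝ (Fin d))}
    (hC : IsRationalPolyhedralCone C) {x y : EuclideanSpace ℝ (Fin d)}
    (hx : x ∈ C) (hy : y ∈ C) : x + y ∈ C := by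
  obtain ⟨k, v, -, rfl⟩ := hC
  obtain ⟨a, ha, rfl⟩ := hx
  obtain ⟨b, hb, rfl⟩ := hy
  exact ⟨a + b, fun i => add_nonneg (ha i) (hb i), by
    simp [add_smul, Finset.sum_add_distrib]⟩

/-- If `p` has maximal norm in `P ∩ C` and `x, y ∈ C` each have inner product with `p`
exceeding `‖p‖²/2`, then `x + y ∉ P`. -/
theorem sum_of_far_points_escapes_polytope (d : ℕ)
    (C P : Set (EuclideanSpace ℝ (Fin d)))
    (hC : IsRationalPolyhedralCone C) (hCpt : IsPointed C)
    (hPcompact : IsCompact P) (hPC : (P ∩ C).Nonempty)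
    (p : EuclideanSpace ℝ (Fin d)) (hp : p ∈ P ∩ C)
    (hmax : ∀ q ∈ P ∩ C, ‖q‖ ≤ ‖p‖)
    (x y : EuclideanSpace ℝ (Fin d)) (hx : x ∈ C) (hy : y ∈ C)
    (hxp : ‖p‖ ^ 2 / 2 < ⟪x, p⟫) (hyp : ‖p‖ ^ 2 / 2 < ⟪y, p⟫) :
    x + y ∉ P := by
  intro hxy
  have hle := (real_inner_le_norm (x + y) p).trans
    (mul_le_mul_of_nonneg_right (hmax _ ⟨hxy, hC.add_mem hx hy⟩) (norm_nonneg p))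
  rw [inner_add_left] at hle
  linarith [sq ‖p‖]
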